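/- The pushforward measure ψ of the two-dimensional Lebesgue measure on [0,1)² under the map (ξ, x) ↦ (ξ, x, S(ξ, x)) is invariant under the Anosov skew product G, i.e. the pushforward of ψ by G equals ψ. -/

import Mathlib

open Real MeasureTheory Set Filter

noncomputable section

/-- The Euclidean plane. -/
abbrev E2 : Type := EuclideanSpace ℝ (Fin 2)

/-- The unit vector `(cos t, sin t)` in the Euclidean plane. -/
def cs (t : ℝ) : E2 := (WithLp.equiv 2 (Fin 2 → ℝ)).symm ![Real.cos t, Real.sin t]

/-- The vector `(-sin t, cos t)` in the Euclidean plane. -/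
def cs' (t : ℝ) : E2 := (WithLp.equiv 2 (Fin 2 → ℝ)).symm ![-Real.sin t, Real.cos t]

/-- The two-dimensional Weierstrass function
`W(x) = ∑_{n≥0} 2^{-n/2} (cos (2π 2^n x), sin (2π 2^n x))`. -/
def Wfn (x : ℝ) : E2 := ∑' n : ℕ, (2 : ℝ) ^ (-(n : ℝ) / 2) • cs (2 * π * 2 ^ n * x)

/-- `dig j ξ` is the `j`-th binary digit of `ξ`: `⌊2^j ξ⌋ mod 2` (as a real number). -/
def dig (j : ℕ) (ξ : ℝ) : ℝ := ((⌊(2 : ℝ) ^ j * ξ⌋ % 2 : ℤ) : ℝ)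

/-- `rho n ξ = ∑_{i=1}^n d_{n+1-i}(ξ) 2^{-i}`. -/
def rho (n : ℕ) (ξ : ℝ) : ℝ := ∑ i ∈ Finset.Icc 1 n, dig (n + 1 - i) ξ / 2 ^ i

/-- `x` is a dyadic rational. -/
def dyadic (x : ℝ) : Prop := ∃ (k : ℕ) (m : ℤ), x = (m : ℝ) / 2 ^ k

/-- The stable-direction function
`S(ξ,x) = -2π ∑_{n≥1} 2^{-n/2} (-sin (2π(ρ_n(ξ)+x/2^n)), cos (2π(ρ_n(ξ)+x/2^n)))`. -/
def Sfn (ξ x : ℝ) : E2 :=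
  (-(2 * π)) • ∑' n : ℕ,
    (2 : ℝ) ^ (-((n : ℝ) + 1) / 2) • cs' (2 * π * (rho (n + 1) ξ + x / 2 ^ (n + 1)))

/-- The function `H` given by the doubly infinite series
`H(ξ,x) = ∑_{n≥0} 2^{-n/2} ((cos,sin)(2π 2^n x) - (1,0))
        + ∑_{k≥1} 2^{k/2} ((cos,sin)(2π(ρ_k(ξ)+x/2^k)) - (cos,sin)(2π ρ_k(ξ)))`. -/
def Hfn (ξ x : ℝ) : E2 :=
  (∑' n : ℕ, (2 : ℝ) ^ (-(n : ℝ) / 2) •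
      (cs (2 * π * 2 ^ n * x) - (WithLp.equiv 2 (Fin 2 → ℝ)).symm ![1, 0]))
  + ∑' k : ℕ, (2 : ℝ) ^ (((k : ℝ) + 1) / 2) •
      (cs (2 * π * (rho (k + 1) ξ + x / 2 ^ (k + 1))) - cs (2 * π * rho (k + 1) ξ))

/-- The baker transformation `B(ξ,x) = (2ξ mod 1, (⌊2ξ⌋ + x)/2)`. -/
def baker (p : ℝ × ℝ) : ℝ × ℝ :=
  (Int.fract (2 * p.1), ((⌊2 * p.1⌋ : ℝ) + p.2) / 2)

/-- The unit square `[0,1)²`. -/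
def usq : Set (ℝ × ℝ) := Ico (0:ℝ) 1 ×ˢ Ico (0:ℝ) 1

/-- The explicit formula for the `N`-th backward iterate of the baker transformation:
`B^{-N}(ξ,x) = (ξ/2^N + ∑_{j=1}^N d_j(x) 2^{-(N+1-j)}, 2^N x mod 1)`. -/
def bakerInvN (N : ℕ) (p : ℝ × ℝ) : ℝ × ℝ :=
  (p.1 / 2 ^ N + ∑ j ∈ Finset.Icc 1 N, dig j p.2 / 2 ^ (N + 1 - j),
    Int.fract ((2 : ℝ) ^ N * p.2))

/-- The Anosov skew product
`G(ξ,x,v) = (B(ξ,x), 2^{1/2} v + 2π(-sin, cos)(2π B₂(ξ,x)))`. -/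
def Gfn (q : (ℝ × ℝ) × E2) : (ℝ × ℝ) × E2 :=
  (baker q.1, (2 : ℝ) ^ ((1:ℝ)/2) • q.2 + (2 * π) • cs' (2 * π * (baker q.1).2))

lemma norm_cs' (t : ℝ) : ‖cs' t‖ = 1 := by
  simp [cs', EuclideanSpace.norm_eq, Fin.sum_univ_two]

lemma measurable_cs' : Measurable cs' := by
  unfold cs'
  refine (WithLp.measurable_toLp 2 (Fin 2 → ℝ)).comp (measurable_pi_iff.2 fun i => ?_)
  fin_cases i
  · exact Real.measurable_sin.neg
  · exact Real.measurable_cos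

lemma measurable_dig (j : ℕ) : Measurable (dig j) := by
  have h : Measurable fun k : ℤ => ((k % 2 : ℤ) : ℝ) := measurable_from_top
  exact h.comp (Int.measurable_floor.comp (measurable_const_mul ((2 : ℝ) ^ j)))

lemma measurable_rho (n : ℕ) : Measurable (rho n) :=
  Finset.measurable_fun_sum _ fun _ _ => (measurable_dig _).div_const _

/-- The weight `2^{-(n+1)/2}` as a geometric sequence. -/
lemma two_rpow_neg_half (n : ℕ) :
    (2 : ℝ) ^ (-((n : ℝ) + 1) / 2) = ((2 : ℝ) ^ (-(1 : ℝ) / 2)) ^ (n + 1) := by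
  rw [← Real.rpow_natCast, ← Real.rpow_mul two_pos.le]
  congr 1
  push_cast
  ring

lemma summable_smul_cs' (t : ℕ → ℝ) :
    Summable fun n : ℕ => (2 : ℝ) ^ (-((n : ℝ) + 1) / 2) • cs' (t n) := by
  have h1 : (2 : ℝ) ^ (-(1 : ℝ) / 2) < 1 :=
    Real.rpow_lt_one_of_one_lt_of_neg one_lt_two (by norm_num)
  have h0 : (0 : ℝ) ≤ (2 : ℝ) ^ (-(1 : ℝ) / 2) := by positivity
  refine Summable.of_norm_bounded
    (g := fun n : ℕ => ((2 : ℝ) ^ (-(1 : ℝ) / 2)) ^ (n + 1))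
    ((summable_nat_add_iff 1).2 (summable_geometric_of_lt_one h0 h1)) fun n => ?_
  rw [norm_smul, norm_cs', mul_one, two_rpow_neg_half, Real.norm_of_nonneg (by positivity)]

lemma measurable_Sfn : Measurable fun p : ℝ × ℝ => Sfn p.1 p.2 := by
  unfold Sfn
  refine Measurable.const_smul (X := E2) ?_ (-(2 * π))
  refine measurable_of_tendsto_metrizable (fun N => ?_) (tendsto_pi_nhds.2 fun p : ℝ × ℝ =>
    (summable_smul_cs' fun n => 2 * π * (rho (n + 1) p.1 + p.2 / 2 ^ (n + 1))).hasSum.tendsto_sum_nat)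
  refine Finset.measurable_fun_sum _ fun n _ =>
    Measurable.const_smul (X := E2) ?_ ((2 : ℝ) ^ (-((n : ℝ) + 1) / 2))
  exact measurable_cs'.comp
    ((((measurable_rho _).comp measurable_fst).add (measurable_snd.div_const _)).const_mul _)

lemma measurable_baker : Measurable baker := by
  have h : Measurable fun p : ℝ × ℝ => 2 * p.1 := measurable_fst.const_mul 2
  have hc : Measurable fun k : ℤ => (k : ℝ) := measurable_from_top
  exact (measurable_fract.comp h).prodMk
    (((hc.comp (Int.measurable_floor.comp h)).add measurable_snd).div_const 2)

lemma measurable_Gfn : Measurable Gfn := by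
  have hb : Measurable fun q : (ℝ × ℝ) × E2 => baker q.1 := measurable_baker.comp measurable_fst
  have hc : Measurable fun q : (ℝ × ℝ) × E2 => cs' (2 * π * (baker q.1).2) :=
    measurable_cs'.comp (hb.snd.const_mul (2 * π))
  have hv : Measurable fun q : (ℝ × ℝ) × E2 => q.2 := measurable_snd
  exact hb.prodMk ((hv.const_smul ((2 : ℝ) ^ ((1 : ℝ) / 2))).add (hc.const_smul (2 * π)))

/-- Doubling modulo one shifts binary digits. -/
lemma dig_fract_two_mul {j : ℕ} (hj : 1 ≤ j) (ξ : ℝ) :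
    dig j (Int.fract (2 * ξ)) = dig (j + 1) ξ := by
  obtain ⟨k, rfl⟩ := Nat.exists_eq_add_of_le' hj
  unfold dig
  have h : (2 : ℝ) ^ (k + 1) * Int.fract (2 * ξ)
      = (2 : ℝ) ^ (k + 1 + 1) * ξ - ((2 * (2 ^ k * ⌊2 * ξ⌋) : ℤ) : ℝ) := by
    rw [Int.fract]
    push_cast
    ring
  rw [h, Int.floor_sub_intCast, Int.sub_mul_emod_self_left]

lemma dig_one_of_mem {ξ : ℝ} (h : ξ ∈ Ico (0 : ℝ) 1) : dig 1 ξ = ⌊2 * ξ⌋ := by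
  have h0 : 0 ≤ ⌊2 * ξ⌋ := Int.floor_nonneg.2 (by linarith [h.1])
  have h1 : ⌊2 * ξ⌋ < 2 := Int.floor_lt.2 (by push_cast; linarith [h.2])
  rw [dig, pow_one, Int.emod_eq_of_lt h0 h1]

lemma rho_succ (n : ℕ) (ξ : ℝ) :
    rho (n + 1) ξ = rho n (Int.fract (2 * ξ)) + dig 1 ξ / 2 ^ (n + 1) := by
  unfold rho
  rw [Finset.sum_Icc_succ_top (by omega), Nat.add_sub_cancel_left]
  congr 1
  refine Finset.sum_congr rfl fun i hi => ?_
  rw [Finset.mem_Icc] at hi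
  rw [dig_fract_two_mul (by omega)]
  congr 2
  omega

lemma rho_add_baker (n : ℕ) {p : ℝ × ℝ} (hp : p ∈ usq) :
    rho n (baker p).1 + (baker p).2 / 2 ^ n = rho (n + 1) p.1 + p.2 / 2 ^ (n + 1) := by
  rw [rho_succ, dig_one_of_mem hp.1]
  simp only [baker]
  field_simp
  ring

lemma Sfn_baker {p : ℝ × ℝ} (hp : p ∈ usq) :
    Sfn (baker p).1 (baker p).2
      = (2 : ℝ) ^ ((1 : ℝ) / 2) • Sfn p.1 p.2 + (2 * π) • cs' (2 * π * (baker p).2) := by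
  have hw : (2 : ℝ) ^ ((1 : ℝ) / 2) * (2 : ℝ) ^ (-(1 : ℝ) / 2) = 1 := by
    rw [← Real.rpow_add two_pos]
    norm_num
  have h0 := rho_add_baker 0 hp
  simp only [rho, zero_add, Finset.Icc_eq_empty_of_lt zero_lt_one, Finset.sum_empty, pow_zero,
    div_one] at h0
  have hS : Sfn p.1 p.2 = (-(2 * π)) • ((2 : ℝ) ^ (-(1 : ℝ) / 2) • cs' (2 * π * (baker p).2)
      + (2 : ℝ) ^ (-(1 : ℝ) / 2) • ∑' n : ℕ, (2 : ℝ) ^ (-((n : ℝ) + 1) / 2) •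
        cs' (2 * π * (rho (n + 1) (baker p).1 + (baker p).2 / 2 ^ (n + 1)))) := by
    rw [Sfn, (summable_smul_cs' _).tsum_eq_zero_add]
    congr 2
    · simp only [CharP.cast_eq_zero, zero_add, h0, rho]
    · rw [← tsum_const_smul'']
      refine tsum_congr fun n => ?_
      rw [rho_add_baker _ hp, smul_smul, two_rpow_neg_half, two_rpow_neg_half, ← pow_succ']
  rw [hS, Sfn]
  set A := cs' (2 * π * (baker p).2)
  set T := ∑' n : ℕ, (2 : ℝ) ^ (-((n : ℝ) + 1) / 2) •
    cs' (2 * π * (rho (n + 1) (baker p).1 + (baker p).2 / 2 ^ (n + 1)))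
  rw [← smul_add, smul_comm (-(2 * π)), smul_smul, hw, one_smul, smul_add]
  module

lemma measurePreserving_two_mul_prod_div_two :
    MeasurePreserving (Prod.map (fun ξ : ℝ => 2 * ξ) fun x : ℝ => 2⁻¹ * x) volume volume := by
  refine ⟨(measurable_const_mul 2).prodMap (measurable_const_mul 2⁻¹), ?_⟩
  rw [Measure.volume_eq_prod, ← Measure.map_prod_map _ _ (measurable_const_mul 2)
    (measurable_const_mul 2⁻¹), Real.map_volume_mul_left two_ne_zero,
    Real.map_volume_mul_left (inv_ne_zero two_ne_zero), Measure.prod_smul_left,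
    Measure.prod_smul_right, smul_smul, ← ENNReal.ofReal_mul (abs_nonneg _)]
  norm_num

/-- The branch of the baker transformation on which `⌊2ξ⌋ = k`, extended to the plane. -/
lemma measurePreserving_baker_branch (k : ℝ) :
    MeasurePreserving (fun p : ℝ × ℝ => (2 * p.1 - k, (k + p.2) / 2)) volume volume := by
  have h := (measurePreserving_add_right (volume : Measure (ℝ × ℝ)) (-k, k / 2)).comp
    measurePreserving_two_mul_prod_div_two
  convert h using 1
  ext p <;> simp <;> ring

lemma map_baker_restrict (k : ℤ) :
    Measure.map baker (volume.restrict (Ico ((k : ℝ) / 2) ((k + 1) / 2) ×ˢ Ico (0 : ℝ) 1))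
      = volume.restrict (Ico (0 : ℝ) 1 ×ˢ Ico ((k : ℝ) / 2) ((k + 1) / 2)) := by
  have hT : MeasurableSet (Ico (0 : ℝ) 1 ×ˢ Ico ((k : ℝ) / 2) ((k + 1) / 2)) :=
    measurableSet_Ico.prod measurableSet_Ico
  have hpre : (fun p : ℝ × ℝ => (2 * p.1 - k, (k + p.2) / 2)) ⁻¹'
      (Ico (0 : ℝ) 1 ×ˢ Ico ((k : ℝ) / 2) ((k + 1) / 2))
      = Ico ((k : ℝ) / 2) ((k + 1) / 2) ×ˢ Ico (0 : ℝ) 1 := by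
    ext p
    simp only [mem_preimage, mem_prod, mem_Ico]
    constructor <;> rintro ⟨⟨h1, h2⟩, h3, h4⟩ <;> refine ⟨⟨?_, ?_⟩, ?_, ?_⟩ <;> linarith
  rw [← ((measurePreserving_baker_branch k).restrict_preimage hT).map_eq, hpre]
  refine Measure.map_congr ((ae_restrict_iff' (measurableSet_Ico.prod measurableSet_Ico)).2
    (ae_of_all _ fun p hp => ?_))
  have hk : ⌊2 * p.1⌋ = k := Int.floor_eq_iff.2
    ⟨by linarith [hp.1.1], by linarith [hp.1.2]⟩
  simp only [baker, Int.fract, hk]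

lemma map_baker_usq :
    Measure.map baker ((volume : Measure (ℝ × ℝ)).restrict usq) = volume.restrict usq := by
  have hI : Ico (0 : ℝ) 1 = Ico ((0 : ℤ) / 2 : ℝ) (((0 : ℤ) + 1) / 2)
      ∪ Ico ((1 : ℤ) / 2 : ℝ) (((1 : ℤ) + 1) / 2) := by
    norm_num [Ico_union_Ico_eq_Ico]
  have hd : Disjoint (Ico ((0 : ℤ) / 2 : ℝ) (((0 : ℤ) + 1) / 2))
      (Ico ((1 : ℤ) / 2 : ℝ) (((1 : ℤ) + 1) / 2)) := by
    norm_num [Ico_disjoint_Ico]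
  have hl : usq = Ico ((0 : ℤ) / 2 : ℝ) (((0 : ℤ) + 1) / 2) ×ˢ Ico (0 : ℝ) 1
      ∪ Ico ((1 : ℤ) / 2 : ℝ) (((1 : ℤ) + 1) / 2) ×ˢ Ico (0 : ℝ) 1 := by
    rw [← union_prod, ← hI, usq]
  have hr : usq = Ico (0 : ℝ) 1 ×ˢ Ico ((0 : ℤ) / 2 : ℝ) (((0 : ℤ) + 1) / 2)
      ∪ Ico (0 : ℝ) 1 ×ˢ Ico ((1 : ℤ) / 2 : ℝ) (((1 : ℤ) + 1) / 2) := by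
    rw [← prod_union, ← hI, usq]
  calc Measure.map baker ((volume : Measure (ℝ × ℝ)).restrict usq)
      = volume.restrict (Ico (0 : ℝ) 1 ×ˢ Ico ((0 : ℤ) / 2 : ℝ) (((0 : ℤ) + 1) / 2))
        + volume.restrict (Ico (0 : ℝ) 1 ×ˢ Ico ((1 : ℤ) / 2 : ℝ) (((1 : ℤ) + 1) / 2)) := by
        rw [hl, Measure.restrict_union (Disjoint.set_prod_left hd _ _)
          (measurableSet_Ico.prod measurableSet_Ico), Measure.map_add _ _ measurable_baker,
          map_baker_restrict, map_baker_restrict]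
    _ = volume.restrict usq := by
        rw [hr, Measure.restrict_union (Disjoint.set_prod_right hd _ _)
          (measurableSet_Ico.prod measurableSet_Ico)]

/-- The pushforward `ψ = λ² ∘ (id, S)^{-1}` of Lebesgue measure on `[0,1)²` under
`(ξ,x) ↦ (ξ, x, S(ξ,x))` is invariant under the Anosov skew product `G`. -/
theorem SBR_measure_G_invariant :
    Measure.map Gfn
        (Measure.map (fun p : ℝ × ℝ => (p, Sfn p.1 p.2))
          ((volume : Measure (ℝ × ℝ)).restrict usq))
      = Measure.map (fun p : ℝ × ℝ => (p, Sfn p.1 p.2))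
          ((volume : Measure (ℝ × ℝ)).restrict usq) := by
  have hF : Measurable fun p : ℝ × ℝ => (p, Sfn p.1 p.2) := measurable_id.prodMk measurable_Sfn
  rw [Measure.map_map measurable_Gfn hF]
  conv_rhs => rw [← map_baker_usq, Measure.map_map hF measurable_baker]
  refine Measure.map_congr ((ae_restrict_iff' (measurableSet_Ico.prod measurableSet_Ico)).2
    (ae_of_all _ fun p hp => ?_))
  simp only [Function.comp_apply, Gfn, Sfn_baker hp]

end
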